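/- Suppose y ∈ C^{2m}(0,∞) satisfies the system -Δ_α y_k = y_{k+1} for k = 0,…,m-2 and -Δ_α y_{m-1} = φ on (0,∞), where y_k = (-Δ_α)^k y, φ ≥ 0 continuous, and the boundary conditions lim_{r→0} r^α (Δ_α^j y)'(r) = 0 for 0 ≤ j ≤ m-1 and lim_{r→∞} Δ_α^j y(r) = 0 for 0 ≤ j ≤ m hold. Then y ≥ 0 on (0,∞). -/

import Mathlib

open Filter

/-- The α-generalized radial Laplacian: Δ_α v(r) = v''(r) + (α/r) v'(r). -/
noncomputable def lapl (α : ℝ) (v : ℝ → ℝ) : ℝ → ℝ :=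
  fun r => deriv (deriv v) r + (α / r) * deriv v r

/-- The j-fold iterate of -Δ_α. -/
noncomputable def negLaplIter (α : ℝ) (j : ℕ) : (ℝ → ℝ) → (ℝ → ℝ) :=
  (fun v r => -(lapl α v r))^[j]

theorem aux_reg (α : ℝ) (v : ℝ → ℝ) (n : ℕ)
    (hv : ContDiffOn ℝ ((n + 2 : ℕ) : WithTop ℕ∞) v (Set.Ioi 0)) :
    ContDiffOn ℝ (n : WithTop ℕ∞) (fun r => -(lapl α v r)) (Set.Ioi 0) := by
  have h1 : ContDiffOn ℝ ((n + 1 : ℕ) : WithTop ℕ∞) (deriv v) (Set.Ioi 0) :=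
    hv.deriv_of_isOpen isOpen_Ioi (by norm_cast)
  have h2 : ContDiffOn ℝ (n : WithTop ℕ∞) (deriv (deriv v)) (Set.Ioi 0) :=
    h1.deriv_of_isOpen isOpen_Ioi (by norm_cast)
  have h3 : ContDiffOn ℝ (n : WithTop ℕ∞) (fun r : ℝ => α / r) (Set.Ioi 0) :=
    contDiffOn_const.div contDiffOn_id (fun x hx => ne_of_gt hx)
  exact (h2.add (h3.mul (h1.of_le (by norm_cast; omega)))).neg

theorem aux_pos (α : ℝ) (v : ℝ → ℝ)
    (hv : ContDiffOn ℝ ((2 : ℕ) : WithTop ℕ∞) v (Set.Ioi 0))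
    (hl : ∀ r : ℝ, 0 < r → 0 ≤ -(lapl α v r))
    (h0 : Tendsto (fun r : ℝ => r ^ α * deriv v r) (nhdsWithin 0 (Set.Ioi 0)) (nhds 0))
    (hinf : Tendsto v atTop (nhds 0)) : ∀ r : ℝ, 0 < r → 0 ≤ v r := by
  have h1 : ContDiffOn ℝ ((1 : ℕ) : WithTop ℕ∞) (deriv v) (Set.Ioi 0) :=
    hv.deriv_of_isOpen isOpen_Ioi (by norm_cast)
  have dv : ∀ r : ℝ, 0 < r → DifferentiableAt ℝ v r := fun r hr =>
    (hv.differentiableOn (by norm_num)).differentiableAt (Ioi_mem_nhds hr)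
  have ddv : ∀ r : ℝ, 0 < r → DifferentiableAt ℝ (deriv v) r := fun r hr =>
    (h1.differentiableOn (by norm_num)).differentiableAt (Ioi_mem_nhds hr)
  have hw : ∀ r : ℝ, 0 < r →
      HasDerivAt (fun r : ℝ => r ^ α * deriv v r) (r ^ α * lapl α v r) r := by
    intro r hr
    have := (Real.hasDerivAt_rpow_const (p := α) (Or.inl hr.ne')).mul (ddv r hr).hasDerivAt
    refine HasDerivAt.congr_deriv this ?_
    rw [Real.rpow_sub_one hr.ne']
    unfold lapl
    field_simp
    ring
  have anti : AntitoneOn (fun r : ℝ => r ^ α * deriv v r) (Set.Ioi 0) := by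
    apply antitoneOn_of_deriv_nonpos (convex_Ioi 0)
    · exact fun r hr => (hw r hr).continuousAt.continuousWithinAt
    · rw [interior_Ioi]
      exact fun r hr => (hw r hr).differentiableAt.differentiableWithinAt
    · rw [interior_Ioi]
      intro r hr
      rw [(hw r hr).deriv]
      have := hl r hr
      exact mul_nonpos_of_nonneg_of_nonpos (Real.rpow_nonneg (le_of_lt hr) _) (by linarith)
  have hd : ∀ r : ℝ, 0 < r → deriv v r ≤ 0 := by
    intro r hr
    have h : r ^ α * deriv v r ≤ 0 := by
      apply ge_of_tendsto h0
      filter_upwards [Ioo_mem_nhdsGT hr] with s hs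
      exact anti hs.1 hr hs.2.le
    have hp := Real.rpow_pos_of_pos hr α
    by_contra hc
    push Not at hc
    have := mul_pos hp hc
    linarith
  have antiv : AntitoneOn v (Set.Ioi 0) := by
    apply antitoneOn_of_deriv_nonpos (convex_Ioi 0)
    · exact hv.continuousOn
    · rw [interior_Ioi]
      exact fun r hr => (dv r hr).differentiableWithinAt
    · rw [interior_Ioi]
      exact hd
  intro r hr
  apply le_of_tendsto hinf
  filter_upwards [eventually_ge_atTop r] with s hs
  exact antiv hr (lt_of_lt_of_le hr hs) hs

theorem aux_succ (α : ℝ) (j : ℕ) (y : ℝ → ℝ) :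
    negLaplIter α (j + 1) y = fun r => -(lapl α (negLaplIter α j y) r) := by
  unfold negLaplIter
  rw [Function.iterate_succ_apply']

theorem stmt_12 (m : ℕ) (hm : 1 ≤ m) (α : ℝ) (hα : -1 < α)
    (y φ : ℝ → ℝ) (hy : ContDiffOn ℝ (2 * m) y (Set.Ioi 0))
    (hφcont : ContinuousOn φ (Set.Ioi 0)) (hφ : ∀ r : ℝ, 0 < r → 0 ≤ φ r)
    (hsys : ∀ r : ℝ, 0 < r → negLaplIter α m y r = φ r)
    (hbc0 : ∀ j : ℕ, j ≤ m - 1 →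
      Tendsto (fun r : ℝ => r ^ α * deriv (negLaplIter α j y) r)
        (nhdsWithin 0 (Set.Ioi 0)) (nhds 0))
    (hbcInf : ∀ j : ℕ, j ≤ m →
      Tendsto (negLaplIter α j y) atTop (nhds 0)) :
    ∀ r : ℝ, 0 < r → 0 ≤ y r := by
  have reg : ∀ j k : ℕ, j + k = m →
      ContDiffOn ℝ ((2 * k : ℕ) : WithTop ℕ∞) (negLaplIter α j y) (Set.Ioi 0) := by
    intro j
    induction j with
    | zero =>
      intro k hk
      have : k = m := by omega
      subst this
      have e : ((2 * k : ℕ) : WithTop ℕ∞) = 2 * (k : WithTop ℕ∞) := by push_cast; rfl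
      rw [e]
      exact hy
    | succ j ih =>
      intro k hk
      rw [aux_succ]
      exact aux_reg α _ (2 * k) (ih (k + 1) (by omega))
  have main : ∀ k j : ℕ, j + k = m → ∀ r : ℝ, 0 < r → 0 ≤ negLaplIter α j y r := by
    intro k
    induction k with
    | zero =>
      intro j hj r hr
      have : j = m := by omega
      subst this
      rw [hsys r hr]
      exact hφ r hr
    | succ k ih =>
      intro j hj
      refine aux_pos α _ ((reg j (k + 1) hj).of_le (by norm_cast; omega)) ?_
        (hbc0 j (by omega)) (hbcInf j (by omega))
      intro r hr
      have := ih (j + 1) (by omega) r hr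
      rwa [aux_succ] at this
  exact main m 0 (by omega)
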